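/- The class of fp-injective left R-modules is closed under cokernels of monomorphisms if and only if R is left coherent. -/

import Mathlib

open CategoryTheory

universe u

/-- The `n`-th Ext group `Ext^n_R(P, M)` of two left `R`-modules, computed in the
abelian category of `R`-modules (as a `ℤ`-linear category, so that `R` may be
noncommutative). -/
noncomputable def ExtGrp (R : Type u) [Ring R] (n : ℕ)
    (P M : Type u) [AddCommGroup P] [Module R P] [AddCommGroup M] [Module R M] : Type u :=
  ((Ext ℤ (ModuleCat.{u} R) n).obj (Opposite.op (ModuleCat.of R P))).obj (ModuleCat.of R M)

/-- A left `R`-module `M` is strongly fp-injective if `Ext^n_R(P, M) = 0` for every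
finitely presented left `R`-module `P` and every `n ≥ 1`. -/
def StronglyFpInjective (R : Type u) [Ring R] (M : Type u) [AddCommGroup M] [Module R M] : Prop :=
  ∀ (P : Type u) [AddCommGroup P] [Module R P], Module.FinitePresentation R P →
    ∀ n : ℕ, 1 ≤ n → Subsingleton (ExtGrp R n P M)

/-- A left `R`-module `M` is fp-injective if `Ext¹_R(P, M) = 0` for every finitely
presented left `R`-module `P`. -/
def FpInjective (R : Type u) [Ring R] (M : Type u) [AddCommGroup M] [Module R M] : Prop :=
  ∀ (P : Type u) [AddCommGroup P] [Module R P], Module.FinitePresentation R P →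
    Subsingleton (ExtGrp R 1 P M)

section Extension

variable {R : Type*} [Ring R]

lemma exists_comp_eq_of_ker_le {F X M : Type*} [AddCommGroup F] [Module R F] [AddCommGroup X]
    [Module R X] [AddCommGroup M] [Module R M] {p : F →ₗ[R] X} (hp : Function.Surjective p)
    {f : F →ₗ[R] M} (hpf : LinearMap.ker p ≤ LinearMap.ker f) :
    ∃ g : X →ₗ[R] M, ∀ x, g (p x) = f x := by
  refine ⟨(LinearMap.ker p).liftQ f hpf ∘ₗ (p.quotKerEquivOfSurjective hp).symm.toLinearMap,
    fun x ↦ ?_⟩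
  have : (p.quotKerEquivOfSurjective hp).symm (p x) = (LinearMap.ker p).mkQ x :=
    (LinearEquiv.symm_apply_eq _).mpr rfl
  simp [this]

/-- Every linear map from the kernel of `p` to `M` extends to the source of `p`. -/
def ExtendsFromKer {F X : Type*} [AddCommGroup F] [Module R F] [AddCommGroup X] [Module R X]
    (p : F →ₗ[R] X) (M : Type*) [AddCommGroup M] [Module R M] : Prop :=
  ∀ g : LinearMap.ker p →ₗ[R] M, ∃ h : F →ₗ[R] M, ∀ k : LinearMap.ker p, h k = g k

/-- Whether maps extend from the kernel of a surjection from a projective module depends only on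
the target of the surjection. -/
lemma ExtendsFromKer.of_projective {P F X M : Type*} [AddCommGroup P] [Module R P]
    [AddCommGroup F] [Module R F] [AddCommGroup X] [Module R X] [AddCommGroup M] [Module R M]
    [Module.Projective R P] [Module.Projective R F] {p : P →ₗ[R] X} {q : F →ₗ[R] X}
    (hp : Function.Surjective p) (hq : Function.Surjective q) (H : ExtendsFromKer p M) :
    ExtendsFromKer q M := by
  intro g
  obtain ⟨a, ha⟩ := Module.projective_lifting_property q p hq
  obtain ⟨c, hc⟩ := Module.projective_lifting_property p q hp
  have ha' (x : P) : q (a x) = p x := LinearMap.congr_fun ha x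
  have hc' (x : F) : p (c x) = q x := LinearMap.congr_fun hc x
  let b : LinearMap.ker p →ₗ[R] LinearMap.ker q :=
    (a ∘ₗ (LinearMap.ker p).subtype).codRestrict _ fun x ↦ by simp [ha']
  let e : F →ₗ[R] LinearMap.ker q :=
    (LinearMap.id - a ∘ₗ c).codRestrict _ fun x ↦ by simp [ha', hc']
  obtain ⟨ψ, hψ⟩ := H (g ∘ₗ b)
  refine ⟨ψ ∘ₗ c + g ∘ₗ e, fun k ↦ ?_⟩
  have hk : c k ∈ LinearMap.ker p := by simp [hc']
  have h1 : ψ (c k) = g (b ⟨c k, hk⟩) := hψ ⟨c k, hk⟩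
  have h2 : b ⟨c k, hk⟩ + e k = k := by
    ext
    exact add_sub_cancel (a (c k)) (k : F)
  simp only [LinearMap.add_apply, LinearMap.comp_apply]
  rw [h1, ← map_add, h2]

end Extension

section Coherent

variable (R : Type*) [Ring R]

/-- Every finitely generated submodule of `N` is finitely presented. -/
def FGSubmodulesFinitelyPresented (N : Type*) [AddCommGroup N] [Module R N] : Prop :=
  ∀ K : Submodule R N, K.FG → Module.FinitePresentation R K

variable {R}

lemma FGSubmodulesFinitelyPresented.of_injective {N N' : Type*} [AddCommGroup N] [Module R N]
    [AddCommGroup N'] [Module R N'] (f : N →ₗ[R] N') (hf : Function.Injective f)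
    (h : FGSubmodulesFinitelyPresented R N') : FGSubmodulesFinitelyPresented R N := fun K hK ↦
  have := h _ (hK.map f)
  .of_equiv (Submodule.equivMapOfInjective f hf K).symm

lemma FGSubmodulesFinitelyPresented.finitePresentation_of_disjoint_ker {L N N' : Type*}
    [AddCommGroup L] [Module R L] [AddCommGroup N] [Module R N] [AddCommGroup N'] [Module R N']
    [Module.Finite R L] (h : FGSubmodulesFinitelyPresented R N)
    (h' : FGSubmodulesFinitelyPresented R N') (p : L →ₗ[R] N) (q : L →ₗ[R] N')
    (hpq : ∀ x, p x = 0 → q x = 0 → x = 0) : Module.FinitePresentation R L := by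
  have hp : Function.Surjective p.rangeRestrict := p.surjective_rangeRestrict
  have : Module.FinitePresentation R (LinearMap.range p) :=
    h _ (LinearMap.range_eq_map p ▸ Module.Finite.fg_top.map p)
  have : Module.Finite R (LinearMap.ker p.rangeRestrict) :=
    Module.Finite.iff_fg.mpr (Module.FinitePresentation.fg_ker _ hp)
  let i : LinearMap.ker p.rangeRestrict →ₗ[R] N' :=
    q ∘ₗ (LinearMap.ker p.rangeRestrict).subtype
  have hi : Function.Injective i := (injective_iff_map_eq_zero i).mpr fun x hx ↦
    Subtype.ext (hpq x (congrArg Subtype.val x.2) hx)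
  have : Module.FinitePresentation R (LinearMap.ker p.rangeRestrict) :=
    Submodule.topEquiv.finitePresentation_iff.mp (h'.of_injective i hi ⊤ Module.Finite.fg_top)
  exact Module.finitePresentation_of_ker p.rangeRestrict hp

lemma FGSubmodulesFinitelyPresented.prod {N N' : Type*} [AddCommGroup N] [Module R N]
    [AddCommGroup N'] [Module R N'] (h : FGSubmodulesFinitelyPresented R N)
    (h' : FGSubmodulesFinitelyPresented R N') : FGSubmodulesFinitelyPresented R (N × N') :=
  fun K hK ↦
  have : Module.Finite R K := Module.Finite.iff_fg.mpr hK
  h.finitePresentation_of_disjoint_ker h' (LinearMap.fst R N N' ∘ₗ K.subtype)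
    (LinearMap.snd R N N' ∘ₗ K.subtype) fun _ h1 h2 ↦ Subtype.ext (Prod.ext h1 h2)

lemma FGSubmodulesFinitelyPresented.fin_fun (h : FGSubmodulesFinitelyPresented R R) (n : ℕ) :
    FGSubmodulesFinitelyPresented R (Fin n → R) := by
  induction n with
  | zero =>
    intro K _
    infer_instance
  | succ n ih =>
    exact (h.prod ih).of_injective (Fin.consLinearEquiv R fun _ ↦ R).symm.toLinearMap
      (LinearEquiv.injective _)

end Coherent

section EventuallyZero

variable (R : Type*) [Ring R] {ι : Type*} [Preorder ι] [IsDirectedOrder ι] [Nonempty ι]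
  (E : ι → Type*) [∀ i, AddCommGroup (E i)] [∀ i, Module R (E i)]

/-- The families which vanish from some index on. -/
def eventuallyZero : Submodule R (∀ i, E i) where
  carrier := {x | ∃ i, ∀ j, i ≤ j → x j = 0}
  zero_mem' := ⟨Classical.arbitrary ι, fun _ _ ↦ rfl⟩
  add_mem' := by
    rintro x y ⟨i, hi⟩ ⟨j, hj⟩
    obtain ⟨k, hik, hjk⟩ := exists_ge_ge i j
    exact ⟨k, fun l hl ↦ by simp [hi l (hik.trans hl), hj l (hjk.trans hl)]⟩
  smul_mem' := by
    rintro r x ⟨i, hi⟩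
    exact ⟨i, fun l hl ↦ by simp [hi l hl]⟩

variable {R E}

/-- A linear map from a finitely generated module to `eventuallyZero R E` takes values in families
vanishing from a common index on. -/
lemma exists_forall_apply_eq_zero {N : Type*} [AddCommGroup N] [Module R N] [Module.Finite R N]
    (g : N →ₗ[R] eventuallyZero R E) : ∃ i, ∀ j, i ≤ j → ∀ x, (g x).1 j = 0 := by
  classical
  obtain ⟨s, hs⟩ := Module.Finite.fg_top (R := R) (M := N)
  choose f hf using fun x : N ↦ (g x).2
  obtain ⟨i, hi⟩ := (s.image f).exists_le
  refine ⟨i, fun j hj x ↦ ?_⟩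
  have : LinearMap.proj j ∘ₗ (eventuallyZero R E).subtype ∘ₗ g = 0 :=
    LinearMap.ext_on hs fun y hy ↦ hf y j ((hi _ (Finset.mem_image_of_mem f hy)).trans hj)
  exact LinearMap.congr_fun this x

end EventuallyZero

section FpInjective

variable {R : Type u} [Ring R]

lemma subsingleton_extGrp_one_iff_of_resolution {X M : Type u} [AddCommGroup X] [Module R X]
    [AddCommGroup M] [Module R M] (P : ProjectiveResolution (ModuleCat.of R X)) :
    Subsingleton (ExtGrp R 1 X M) ↔ ExtendsFromKer (P.π.f 0).hom M := by
  rw [ExtGrp, ← ModuleCat.isZero_iff_subsingleton, (P.isoExt 1 _).isZero_iff,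
    ← HomologicalComplex.exactAt_iff_isZero_homology,
    HomologicalComplex.exactAt_iff' _ 0 1 2 (by simp) (by simp),
    ShortComplex.moduleCat_exact_iff]
  change (∀ φ : P.complex.X 1 ⟶ ModuleCat.of R M, P.complex.d 2 1 ≫ φ = 0 →
    ∃ ψ : P.complex.X 0 ⟶ ModuleCat.of R M, P.complex.d 1 0 ≫ ψ = φ) ↔ _
  have hex0 : ∀ y, (P.π.f 0).hom y = 0 → ∃ x, (P.complex.d 1 0).hom x = y :=
    (ShortComplex.moduleCat_exact_iff _).mp P.exact₀
  have hex1 : ∀ y, (P.complex.d 1 0).hom y = 0 → ∃ x, (P.complex.d 2 1).hom x = y :=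
    (ShortComplex.moduleCat_exact_iff _).mp (P.exact_succ 0)
  have hd0 (x) : (P.complex.d 1 0).hom x ∈ LinearMap.ker (P.π.f 0).hom :=
    LinearMap.congr_fun (congrArg ModuleCat.Hom.hom P.complex_d_comp_π_f_zero) x
  let d : P.complex.X 1 →ₗ[R] LinearMap.ker (P.π.f 0).hom :=
    (P.complex.d 1 0).hom.codRestrict _ hd0
  have hd : Function.Surjective d := fun k ↦
    have ⟨x, hx⟩ := hex0 k.1 k.2
    ⟨x, Subtype.ext hx⟩
  constructor
  · intro H g
    obtain ⟨ψ, hψ⟩ := H (ModuleCat.ofHom (g ∘ₗ d)) (by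
      ext x
      have hx : d ((P.complex.d 2 1).hom x) = 0 :=
        Subtype.ext
          (LinearMap.congr_fun (congrArg ModuleCat.Hom.hom (P.complex.d_comp_d 2 1 0)) x)
      exact (congrArg g hx).trans (map_zero g))
    refine ⟨ψ.hom, fun k ↦ ?_⟩
    obtain ⟨x, rfl⟩ := hd k
    exact LinearMap.congr_fun (congrArg ModuleCat.Hom.hom hψ) x
  · intro H φ hφ
    have hker : LinearMap.ker d ≤ LinearMap.ker φ.hom := fun x hx ↦ by
      obtain ⟨y, rfl⟩ := hex1 x (congrArg Subtype.val hx)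
      exact LinearMap.congr_fun (congrArg ModuleCat.Hom.hom hφ) y
    obtain ⟨g, hg⟩ := exists_comp_eq_of_ker_le hd hker
    obtain ⟨h, hh⟩ := H g
    refine ⟨ModuleCat.ofHom h, ?_⟩
    ext x
    exact (hh (d x)).trans (hg x)

lemma subsingleton_extGrp_one_iff {F X M : Type u} [AddCommGroup F] [Module R F]
    [AddCommGroup X] [Module R X] [AddCommGroup M] [Module R M] [Module.Projective R F]
    {q : F →ₗ[R] X} (hq : Function.Surjective q) :
    Subsingleton (ExtGrp R 1 X M) ↔ ExtendsFromKer q M := by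
  let P := projectiveResolution (ModuleCat.of R X)
  have : Module.Projective R (P.complex.X 0) :=
    (IsProjective.iff_projective (P.complex.X 0)).mpr (P.projective 0)
  have hP : Function.Surjective (P.π.f 0).hom :=
    (ModuleCat.epi_iff_surjective (P.π.f 0)).mp inferInstance
  rw [subsingleton_extGrp_one_iff_of_resolution P]
  exact ⟨.of_projective hP hq, .of_projective hq hP⟩

lemma FpInjective.exists_extension {M : Type u} [AddCommGroup M] [Module R M]
    (hM : FpInjective R M) {F : Type u} [AddCommGroup F] [Module R F] [Module.Projective R F]
    [Module.Finite R F] (K : Submodule R F) (hK : K.FG) (g : K →ₗ[R] M) :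
    ∃ h : F →ₗ[R] M, h ∘ₗ K.subtype = g := by
  have := Module.finitePresentation_of_projective R F
  have hP := hM (F ⧸ K)
    (Module.finitePresentation_of_surjective K.mkQ K.mkQ_surjective (by simpa using hK))
  rw [subsingleton_extGrp_one_iff K.mkQ_surjective] at hP
  obtain ⟨h, hh⟩ := hP (g ∘ₗ (LinearEquiv.ofEq _ _ K.ker_mkQ).toLinearMap)
  exact ⟨h, LinearMap.ext fun k ↦ hh ⟨k, by simp⟩⟩

lemma fpInjective_of_exists_extension {M : Type u} [AddCommGroup M] [Module R M]
    (H : ∀ (n : ℕ) (K : Submodule R (Fin n → R)), K.FG → ∀ g : K →ₗ[R] M,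
      ∃ h : (Fin n → R) →ₗ[R] M, h ∘ₗ K.subtype = g) : FpInjective R M := by
  intro P _ _ hP
  obtain ⟨n, f, hf⟩ := Module.Finite.exists_fin' R P
  rw [subsingleton_extGrp_one_iff hf]
  intro g
  obtain ⟨h, hh⟩ := H n _ (Module.FinitePresentation.fg_ker f hf) g
  exact ⟨h, LinearMap.congr_fun hh⟩

lemma FpInjective.of_injective {M : Type u} [AddCommGroup M] [Module R M]
    [Module.Injective R M] : FpInjective R M :=
  fpInjective_of_exists_extension fun _ K _ g ↦
    Module.Injective.extension_property R _ _ _ K.subtype K.subtype_injective g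

lemma FpInjective.eventuallyZero {ι : Type u} [Preorder ι] [IsDirectedOrder ι] [Nonempty ι]
    (E : ι → Type u) [∀ i, AddCommGroup (E i)] [∀ i, Module R (E i)]
    [∀ i, Module.Injective R (E i)] : FpInjective R (eventuallyZero R E) := by
  classical
  refine fpInjective_of_exists_extension fun n K hK g ↦ ?_
  have : Module.Finite R K := Module.Finite.iff_fg.mpr hK
  obtain ⟨i, hi⟩ := exists_forall_apply_eq_zero g
  obtain ⟨h, hh⟩ := Module.Injective.extension_property R _ _ _ K.subtype K.subtype_injective
    ((_root_.eventuallyZero R E).subtype ∘ₗ g)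
  have hh' (k : K) : h k = (g k).1 := LinearMap.congr_fun hh k
  let t : (Fin n → R) →ₗ[R] ∀ j, E j :=
    LinearMap.pi fun j ↦ if i ≤ j then 0 else LinearMap.proj j ∘ₗ h
  refine ⟨t.codRestrict _ fun x ↦ ⟨i, fun j hj ↦ by simp [t, hj]⟩, ?_⟩
  ext k j
  by_cases hj : i ≤ j
  · change t k j = _
    simp [t, hj, hi j hj k]
  · change t k j = _
    simp [t, hj, hh']

variable (R) in
lemma exists_injective_embedding (N : Type u) [AddCommGroup N] [Module R N] :
    ∃ (E : Type u) (_ : AddCommGroup E) (_ : Module R E) (f : N →ₗ[R] E),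
      Module.Injective R E ∧ Function.Injective f := by
  let J := Injective.under (ModuleCat.of R N)
  have : Injective (ModuleCat.of R J) := inferInstanceAs (Injective J)
  exact ⟨J, inferInstance, inferInstance, (Injective.ι (ModuleCat.of R N)).hom,
    Module.injective_module_of_injective_object R J,
    (ModuleCat.mono_iff_injective _).mp inferInstance⟩

/-- Over a coherent ring, fp-injective modules are closed under cokernels of monomorphisms. -/
lemma FpInjective.quotient_range {A B : Type u} [AddCommGroup A] [Module R A] [AddCommGroup B]
    [Module R B] (hR : FGSubmodulesFinitelyPresented R R) (f : A →ₗ[R] B)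
    (hf : Function.Injective f) (hA : FpInjective R A) (hB : FpInjective R B) :
    FpInjective R (B ⧸ LinearMap.range f) := by
  refine fpInjective_of_exists_extension fun n K hK g ↦ ?_
  have hKfp := hR.fin_fun n K hK
  obtain ⟨m, p, hp⟩ := Module.Finite.exists_fin' R K
  obtain ⟨l, hl⟩ := Module.projective_lifting_property (LinearMap.range f).mkQ (g ∘ₗ p)
    (Submodule.mkQ_surjective _)
  have hl' (x) : (LinearMap.range f).mkQ (l x) = g (p x) := LinearMap.congr_fun hl x
  let e := LinearEquiv.ofInjective f hf
  let a : LinearMap.ker p →ₗ[R] A := e.symm.toLinearMap ∘ₗ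
    (l ∘ₗ (LinearMap.ker p).subtype).codRestrict _ fun x ↦ by
      rw [← Submodule.ker_mkQ (LinearMap.range f), LinearMap.mem_ker, LinearMap.comp_apply, hl']
      simp
  have ha (x) : f (a x) = l x := congrArg Subtype.val (e.apply_symm_apply _)
  obtain ⟨b, hb⟩ := hA.exists_extension _ (Module.FinitePresentation.fg_ker p hp) a
  have hker : LinearMap.ker p ≤ LinearMap.ker (l - f ∘ₗ b) := fun x hx ↦ by
    have : b x = a ⟨x, hx⟩ := LinearMap.congr_fun hb ⟨x, hx⟩
    simp [this, ha]
  obtain ⟨c, hc⟩ := exists_comp_eq_of_ker_le hp hker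
  obtain ⟨d, hd⟩ := hB.exists_extension K hK c
  refine ⟨(LinearMap.range f).mkQ ∘ₗ d, LinearMap.ext fun k ↦ ?_⟩
  obtain ⟨x, rfl⟩ := hp k
  have hd' : d (p x) = c (p x) := LinearMap.congr_fun hd (p x)
  have hfb : (LinearMap.range f).mkQ (f (b x)) = 0 := by simp
  simp only [LinearMap.comp_apply, Submodule.subtype_apply]
  rw [hd', hc, LinearMap.sub_apply, map_sub, hl', LinearMap.comp_apply, hfb, sub_zero]

/-- If fp-injective modules are closed under cokernels of monomorphisms, then `R` is coherent. -/
lemma finitePresentation_of_fpInjective_quotient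
    (H : ∀ (A B : Type u) [AddCommGroup A] [Module R A] [AddCommGroup B] [Module R B]
      (f : A →ₗ[R] B), Function.Injective f → FpInjective R A → FpInjective R B →
        FpInjective R (B ⧸ LinearMap.range f)) (I : Ideal R) (hI : I.FG) :
    Module.FinitePresentation R I := by
  have : Module.Finite R I := Module.Finite.iff_fg.mpr hI
  obtain ⟨n, π, hπ⟩ := Module.Finite.exists_fin' R I
  let K := LinearMap.ker π
  let ι : Type u := {L : Submodule R (Fin n → R) // L.FG ∧ L ≤ K}
  have : Nonempty ι := ⟨⟨⊥, Submodule.fg_bot, bot_le⟩⟩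
  have : IsDirectedOrder ι := ⟨fun L L' ↦
    ⟨⟨L.1 ⊔ L'.1, L.2.1.sup L'.2.1, sup_le L.2.2 L'.2.2⟩,
      (le_sup_left : L.1 ≤ L.1 ⊔ L'.1), (le_sup_right : L'.1 ≤ L.1 ⊔ L'.1)⟩⟩
  choose E _ _ ε _ hε using fun L : ι ↦ exists_injective_embedding R ((Fin n → R) ⧸ L.1)
  let M := eventuallyZero R E
  have hQ : FpInjective R ((∀ L, E L) ⧸ M) := by
    have := H M (∀ L, E L) M.subtype M.subtype_injective (.eventuallyZero E) .of_injective
    rwa [Submodule.range_subtype] at this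
  let ψ : (Fin n → R) →ₗ[R] ∀ L, E L := LinearMap.pi fun L ↦ ε L ∘ₗ L.1.mkQ
  have hψ (L : ι) (x) : ψ x L = 0 ↔ x ∈ L.1 := by
    simp [ψ, map_eq_zero_iff _ (hε L)]
  have hker : K ≤ LinearMap.ker (M.mkQ ∘ₗ ψ) := fun x hx ↦ by
    rw [LinearMap.ker_comp, Submodule.ker_mkQ]
    exact ⟨⟨R ∙ x, Submodule.fg_span_singleton x, by simpa using hx⟩,
      fun L hL ↦ (hψ L x).mpr (hL (Submodule.mem_span_singleton_self x))⟩
  obtain ⟨φ, hφ⟩ := exists_comp_eq_of_ker_le hπ hker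
  obtain ⟨χ, hχ⟩ := hQ.exists_extension I hI φ
  obtain ⟨θ, hθ⟩ := Module.projective_lifting_property M.mkQ χ M.mkQ_surjective
  let δ : (Fin n → R) →ₗ[R] M := (ψ - θ ∘ₗ I.subtype ∘ₗ π).codRestrict M fun x ↦ by
    have h1 : M.mkQ (θ (π x)) = χ (π x) := LinearMap.congr_fun hθ _
    have h2 : χ (π x) = φ (π x) := LinearMap.congr_fun hχ _
    rw [← M.ker_mkQ, LinearMap.mem_ker, LinearMap.sub_apply, map_sub,
      ← LinearMap.comp_apply, ← hφ, ← h2, ← h1]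
    simp
  obtain ⟨L, hL⟩ := exists_forall_apply_eq_zero δ
  have hKL : K ≤ L.1 := fun x hx ↦ by
    have hx' : π x = 0 := hx
    have := hL L le_rfl x
    rw [← hψ]
    simpa [δ, hx'] using this
  have hK : K.FG := le_antisymm L.2.2 hKL ▸ L.2.1
  exact Module.finitePresentation_of_surjective π hπ hK

end FpInjective

/-- The class of fp-injective left `R`-modules is closed under cokernels of
monomorphisms if and only if `R` is left coherent (every finitely generated left ideal
is finitely presented). -/
theorem fpInjective_closed_under_cokernels_iff_leftCoherent (R : Type u) [Ring R] :
    (∀ (A B : Type u) [AddCommGroup A] [Module R A] [AddCommGroup B] [Module R B]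
      (f : A →ₗ[R] B), Function.Injective f → FpInjective R A → FpInjective R B →
        FpInjective R (B ⧸ LinearMap.range f)) ↔
      (∀ I : Ideal R, I.FG → Module.FinitePresentation R I) := by
  exact ⟨finitePresentation_of_fpInjective_quotient,
    fun hR A B _ _ _ _ f hf hA hB ↦ .quotient_range hR f hf hA hB⟩
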